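/- Let n ≥ 1, let g : ℝⁿ → (symmetric positive-definite n×n real matrices) be smooth, let ψ : ℝⁿ → ℝ be smooth and positive, and let γ : ℝ × [0,t₀) → ℝ^{1+n} be a curve shortening flow in local coordinates with respect to the left warped product metric G_L. Then the angle function Θ_L = ⟨T, ∂r⟩_{G_L} satisfies, at every point (x,t), the evolution equation ∂_t Θ_L = ΔΘ_L + |A|² Θ_L + 2⟨H, D(log ψ)⟩_{G_L} Θ_L − 2 T(Θ_L) ⟨T, D(log ψ)⟩_{G_L}, where D(log ψ) is evaluated at the ℝⁿ-component of γ(x,t). -/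

import Mathlib

open scoped BigOperators

noncomputable section

/-- Inner product of two vectors with respect to a metric matrix `G`. -/
def minner {m : ℕ} (G : Matrix (Fin m) (Fin m) ℝ) (u v : Fin m → ℝ) : ℝ :=
  ∑ α, ∑ β, u α * G α β * v β

/-- Norm of a vector with respect to a metric matrix `G`. -/
def mnorm {m : ℕ} (G : Matrix (Fin m) (Fin m) ℝ) (v : Fin m → ℝ) : ℝ :=
  Real.sqrt (minner G v v)

/-- Christoffel symbols `Γ^α_{βγ}` of the metric `G` at the point `p`:
`Γ^α_{βγ} = (1/2) Σ_δ (G⁻¹)^{αδ}(∂_β G_{δγ} + ∂_γ G_{δβ} − ∂_δ G_{βγ})`. -/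
def christoffel {m : ℕ} (G : (Fin m → ℝ) → Matrix (Fin m) (Fin m) ℝ)
    (p : Fin m → ℝ) (α β γ : Fin m) : ℝ :=
  (1 / 2) * ∑ δ, (G p)⁻¹ α δ *
      (fderiv ℝ (fun q => G q δ γ) p (Pi.single β 1)
        + fderiv ℝ (fun q => G q δ β) p (Pi.single γ 1)
        - fderiv ℝ (fun q => G q β γ) p (Pi.single δ 1))

/-- Unit tangent vector `T = ∂ₓc/|∂ₓc|_G` of a curve `c` with respect to the metric `G`. -/
def unitT {m : ℕ} (G : (Fin m → ℝ) → Matrix (Fin m) (Fin m) ℝ)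
    (c : ℝ → Fin m → ℝ) (x : ℝ) : Fin m → ℝ :=
  (mnorm (G (c x)) (deriv c x))⁻¹ • deriv c x

/-- Covariant derivative `∇_T V` of a vector field `V` along the curve `c`. -/
def covT {m : ℕ} (G : (Fin m → ℝ) → Matrix (Fin m) (Fin m) ℝ)
    (c V : ℝ → Fin m → ℝ) (x : ℝ) : Fin m → ℝ :=
  fun α => (mnorm (G (c x)) (deriv c x))⁻¹ *
    (deriv (fun y => V y α) x
      + ∑ β, ∑ δ, christoffel G (c x) α β δ * deriv c x β * V x δ)

/-- Mean curvature vector `H = ∇_T T` of the curve `c`. -/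
def meanCurv {m : ℕ} (G : (Fin m → ℝ) → Matrix (Fin m) (Fin m) ℝ)
    (c : ℝ → Fin m → ℝ) : ℝ → Fin m → ℝ :=
  covT G c (unitT G c)

/-- Directional derivative `T(η) = |∂ₓc|⁻¹ ∂ₓη` of a scalar function along the curve `c`. -/
def Tscal {m : ℕ} (G : (Fin m → ℝ) → Matrix (Fin m) (Fin m) ℝ)
    (c : ℝ → Fin m → ℝ) (η : ℝ → ℝ) (x : ℝ) : ℝ :=
  (mnorm (G (c x)) (deriv c x))⁻¹ * deriv η x

/-- Laplacian `Δη = T(T(η))` along the curve `c`. -/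
def lapScal {m : ℕ} (G : (Fin m → ℝ) → Matrix (Fin m) (Fin m) ℝ)
    (c : ℝ → Fin m → ℝ) (η : ℝ → ℝ) : ℝ → ℝ :=
  Tscal G c (Tscal G c η)

/-- Time covariant derivative `∇_t V` along a flow `γ`. -/
def covTime {m : ℕ} (G : (Fin m → ℝ) → Matrix (Fin m) (Fin m) ℝ)
    (γ V : ℝ → ℝ → Fin m → ℝ) (x t : ℝ) : Fin m → ℝ :=
  fun α => deriv (fun s => V x s α) t
    + ∑ β, ∑ δ, christoffel G (γ x t) α β δ * deriv (fun s => γ x s β) t * V x t δ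

/-- Left warped product metric `g + ψ²(x) dr²` on `ℝ^{1+n}` (index 0 is the circle direction). -/
def gwL {n : ℕ} (g : (Fin n → ℝ) → Matrix (Fin n) (Fin n) ℝ)
    (ψ : (Fin n → ℝ) → ℝ) (p : Fin (n + 1) → ℝ) : Matrix (Fin (n + 1)) (Fin (n + 1)) ℝ :=
  Matrix.of fun α β =>
    Fin.cases (Fin.cases ((ψ fun i => p i.succ) ^ 2) (fun _ => 0) β)
      (fun i => Fin.cases 0 (fun j => g (fun k => p k.succ) i j) β) α

/-- Right warped product metric `φ²(r) g + dr²` on `ℝ^{1+n}` (index 0 is the circle direction). -/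
def gwR {n : ℕ} (g : (Fin n → ℝ) → Matrix (Fin n) (Fin n) ℝ)
    (φ : ℝ → ℝ) (p : Fin (n + 1) → ℝ) : Matrix (Fin (n + 1)) (Fin (n + 1)) ℝ :=
  Matrix.of fun α β =>
    Fin.cases (Fin.cases 1 (fun _ => 0) β)
      (fun i => Fin.cases 0 (fun j => (φ (p 0)) ^ 2 * g (fun k => p k.succ) i j) β) α

/-- The vector `∂r = e₀` in `ℝ^{1+n}`. -/
def er (n : ℕ) : Fin (n + 1) → ℝ := Pi.single 0 1

/-- The gradient `D(log ψ)` of `log ψ` with respect to `(N, g)`, as a vector in `ℝ^{1+n}`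
with vanishing 0-th component. -/
def DlogPsi {n : ℕ} (g : (Fin n → ℝ) → Matrix (Fin n) (Fin n) ℝ)
    (ψ : (Fin n → ℝ) → ℝ) (x : Fin n → ℝ) : Fin (n + 1) → ℝ :=
  Fin.cases 0 (fun i => ∑ k, (g x)⁻¹ i k *
    fderiv ℝ (fun y => Real.log (ψ y)) x (Pi.single k 1))

/-- `|D(log ψ)|² = Σ_{k,l} (g⁻¹)^{kl} ∂_k(log ψ) ∂_l(log ψ)`. -/
def normSqDlogPsi {n : ℕ} (g : (Fin n → ℝ) → Matrix (Fin n) (Fin n) ℝ)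
    (ψ : (Fin n → ℝ) → ℝ) (x : Fin n → ℝ) : ℝ :=
  ∑ k, ∑ l, (g x)⁻¹ k l *
    fderiv ℝ (fun y => Real.log (ψ y)) x (Pi.single k 1) *
    fderiv ℝ (fun y => Real.log (ψ y)) x (Pi.single l 1)

/-- `∇_X ∂r` at the point `p`, i.e. `(∇_X ∂r)^α = Σ_β X^β Γ^α_{β0}`. -/
def covR {m : ℕ} [NeZero m] (G : (Fin m → ℝ) → Matrix (Fin m) (Fin m) ℝ)
    (p : Fin m → ℝ) (X : Fin m → ℝ) : Fin m → ℝ :=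
  fun α => ∑ β, X β * christoffel G p α β 0

/-- The angle function `Θ_L = ⟨T, ∂r⟩_{G_L}` of a flow `γ` in the left warped product. -/
def thetaL {n : ℕ} (g : (Fin n → ℝ) → Matrix (Fin n) (Fin n) ℝ)
    (ψ : (Fin n → ℝ) → ℝ) (γ : ℝ → ℝ → Fin (n + 1) → ℝ) (x t : ℝ) : ℝ :=
  minner (gwL g ψ (γ x t)) (unitT (gwL g ψ) (fun y => γ y t) x) (er n)

/-- The angle function `Θ_R = ⟨T, ∂r⟩_{G_R}` of a flow `γ` in the right warped product. -/
def thetaR {n : ℕ} (g : (Fin n → ℝ) → Matrix (Fin n) (Fin n) ℝ)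
    (φ : ℝ → ℝ) (γ : ℝ → ℝ → Fin (n + 1) → ℝ) (x t : ℝ) : ℝ :=
  minner (gwR g φ (γ x t)) (unitT (gwR g φ) (fun y => γ y t) x) (er n)

section Bilinear

variable {m : ℕ}

lemma minner_eq_dotProduct (G : Matrix (Fin m) (Fin m) ℝ) (u v : Fin m → ℝ) :
    minner G u v = u ⬝ᵥ G.mulVec v := by
  simp only [minner, dotProduct, Matrix.mulVec, Finset.mul_sum, mul_assoc]

lemma minner_add_right (G : Matrix (Fin m) (Fin m) ℝ) (u v w : Fin m → ℝ) :
    minner G u (v + w) = minner G u v + minner G u w := by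
  simp only [minner_eq_dotProduct, Matrix.mulVec_add, dotProduct_add]

lemma minner_smul_left (G : Matrix (Fin m) (Fin m) ℝ) (a : ℝ) (u v : Fin m → ℝ) :
    minner G (a • u) v = a * minner G u v := by
  simp only [minner_eq_dotProduct, smul_dotProduct, smul_eq_mul]

lemma minner_smul_right (G : Matrix (Fin m) (Fin m) ℝ) (a : ℝ) (u v : Fin m → ℝ) :
    minner G u (a • v) = a * minner G u v := by
  simp only [minner_eq_dotProduct, Matrix.mulVec_smul, dotProduct_smul, smul_eq_mul]

lemma minner_smul_matrix (G : Matrix (Fin m) (Fin m) ℝ) (a : ℝ) (u v : Fin m → ℝ) :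
    minner (a • G) u v = a * minner G u v := by
  simp only [minner_eq_dotProduct, Matrix.smul_mulVec, dotProduct_smul, smul_eq_mul]

lemma minner_comm {G : Matrix (Fin m) (Fin m) ℝ} (hG : G.IsSymm) (u v : Fin m → ℝ) :
    minner G u v = minner G v u := by
  rw [minner, minner, Finset.sum_comm]
  refine Finset.sum_congr rfl fun i _ => Finset.sum_congr rfl fun j _ => ?_
  rw [hG.apply]; ring

lemma minner_self_pos {G : Matrix (Fin m) (Fin m) ℝ} (hG : G.PosDef) {u : Fin m → ℝ}
    (hu : u ≠ 0) : 0 < minner G u u := by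
  simpa [minner_eq_dotProduct] using hG.dotProduct_mulVec_pos hu

lemma mnorm_pos {G : Matrix (Fin m) (Fin m) ℝ} (hG : G.PosDef) {u : Fin m → ℝ}
    (hu : u ≠ 0) : 0 < mnorm G u :=
  Real.sqrt_pos.2 (minner_self_pos hG hu)

lemma sq_mnorm {G : Matrix (Fin m) (Fin m) ℝ} (hG : G.PosDef) {u : Fin m → ℝ}
    (hu : u ≠ 0) : mnorm G u ^ 2 = minner G u u :=
  Real.sq_sqrt (minner_self_pos hG hu).le

end Bilinear

/-- Entrywise derivative of the metric matrix `G` at `p` in the direction `w`. -/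
def dmetric {m : ℕ} (G : (Fin m → ℝ) → Matrix (Fin m) (Fin m) ℝ) (p w : Fin m → ℝ) :
    Matrix (Fin m) (Fin m) ℝ :=
  Matrix.of fun i j => fderiv ℝ (fun q => G q i j) p w

section Metric

variable {m : ℕ} {G : (Fin m → ℝ) → Matrix (Fin m) (Fin m) ℝ}

lemma dmetric_smul (G : (Fin m → ℝ) → Matrix (Fin m) (Fin m) ℝ) (p : Fin m → ℝ) (a : ℝ)
    (w : Fin m → ℝ) : dmetric G p (a • w) = a • dmetric G p w := by
  ext i j; simp [dmetric]

lemma isSymm_dmetric (hsymm : ∀ p, (G p).IsSymm) (p w : Fin m → ℝ) :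
    (dmetric G p w).IsSymm := by
  ext i j
  simp only [dmetric, Matrix.transpose_apply, Matrix.of_apply, (hsymm _).apply]

lemma dmetric_apply_eq_sum (G : (Fin m → ℝ) → Matrix (Fin m) (Fin m) ℝ) (p w : Fin m → ℝ)
    (i j : Fin m) :
    dmetric G p w i j = ∑ k, w k * fderiv ℝ (fun q => G q i j) p (Pi.single k 1) := by
  conv_lhs => rw [dmetric, Matrix.of_apply, pi_eq_sum_univ' w, map_sum]
  refine Finset.sum_congr rfl fun k _ => ?_
  rw [map_smul, smul_eq_mul]

lemma sum_metric_mul_christoffel {p : Fin m → ℝ} (hpd : (G p).PosDef) (μ β δ : Fin m) :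
    ∑ α, G p μ α * christoffel G p α β δ =
      (1 / 2) * (fderiv ℝ (fun q => G q μ δ) p (Pi.single β 1)
        + fderiv ℝ (fun q => G q μ β) p (Pi.single δ 1)
        - fderiv ℝ (fun q => G q β δ) p (Pi.single μ 1)) := by
  set f : Fin m → ℝ := fun ν => fderiv ℝ (fun q => G q ν δ) p (Pi.single β 1)
    + fderiv ℝ (fun q => G q ν β) p (Pi.single δ 1)
    - fderiv ℝ (fun q => G q β δ) p (Pi.single ν 1) with hf
  have h : (G p).mulVec ((G p)⁻¹.mulVec f) = f := by
    rw [Matrix.mulVec_mulVec, Matrix.mul_nonsing_inv _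
      ((Matrix.isUnit_iff_isUnit_det _).1 hpd.isUnit), Matrix.one_mulVec]
  have h' := congrFun h μ
  simp only [Matrix.mulVec, dotProduct] at h'
  change _ = 1 / 2 * f μ
  rw [← h', Finset.mul_sum]
  refine Finset.sum_congr rfl fun α _ => ?_
  simp only [christoffel, hf]
  ring

lemma minner_christoffel {p : Fin m → ℝ} (hpd : (G p).PosDef) (X Y Z : Fin m → ℝ) :
    minner (G p) Y (fun α => ∑ β, ∑ δ, christoffel G p α β δ * X β * Z δ) =
      (1 / 2) * (minner (dmetric G p X) Y Z + minner (dmetric G p Z) Y X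
        - minner (dmetric G p Y) X Z) := by
  have h1 : minner (G p) Y (fun α => ∑ β, ∑ δ, christoffel G p α β δ * X β * Z δ) =
      ∑ μ, ∑ β, ∑ δ, Y μ * X β * Z δ * ∑ α, G p μ α * christoffel G p α β δ := by
    refine Finset.sum_congr rfl fun μ _ => ?_
    simp only [Finset.mul_sum]
    rw [Finset.sum_comm]
    refine Finset.sum_congr rfl fun β _ => ?_
    rw [Finset.sum_comm]
    refine Finset.sum_congr rfl fun δ _ => Finset.sum_congr rfl fun α _ => ?_
    ring
  have h2 : minner (dmetric G p X) Y Z = ∑ μ, ∑ β, ∑ δ,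
      Y μ * X β * Z δ * fderiv ℝ (fun q => G q μ δ) p (Pi.single β 1) := by
    refine Finset.sum_congr rfl fun μ _ => ?_
    rw [Finset.sum_comm]
    refine Finset.sum_congr rfl fun δ _ => ?_
    rw [dmetric_apply_eq_sum, Finset.mul_sum, Finset.sum_mul]
    exact Finset.sum_congr rfl fun β _ => by ring
  have h3 : minner (dmetric G p Z) Y X = ∑ μ, ∑ β, ∑ δ,
      Y μ * X β * Z δ * fderiv ℝ (fun q => G q μ β) p (Pi.single δ 1) := by
    refine Finset.sum_congr rfl fun μ _ => Finset.sum_congr rfl fun β _ => ?_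
    rw [dmetric_apply_eq_sum, Finset.mul_sum, Finset.sum_mul]
    exact Finset.sum_congr rfl fun β _ => by ring
  have h4 : minner (dmetric G p Y) X Z = ∑ μ, ∑ β, ∑ δ,
      Y μ * X β * Z δ * fderiv ℝ (fun q => G q β δ) p (Pi.single μ 1) := by
    rw [Finset.sum_comm]
    refine Finset.sum_congr rfl fun β _ => ?_
    rw [Finset.sum_comm]
    refine Finset.sum_congr rfl fun δ _ => ?_
    rw [dmetric_apply_eq_sum, Finset.mul_sum, Finset.sum_mul]
    exact Finset.sum_congr rfl fun μ _ => by ring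
  rw [h1, h2, h3, h4]
  simp only [← Finset.sum_add_distrib, ← Finset.sum_sub_distrib, Finset.mul_sum]
  refine Finset.sum_congr rfl fun μ _ => Finset.sum_congr rfl fun β _ =>
    Finset.sum_congr rfl fun δ _ => ?_
  rw [← Finset.mul_sum, sum_metric_mul_christoffel hpd]
  ring

lemma HasDerivAt.minner (hG : ∀ i j, Differentiable ℝ fun p => G p i j)
    {c a b : ℝ → Fin m → ℝ} {c' a' b' : Fin m → ℝ} {x : ℝ}
    (hc : HasDerivAt c c' x) (ha : HasDerivAt a a' x) (hb : HasDerivAt b b' x) :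
    HasDerivAt (fun y => minner (G (c y)) (a y) (b y))
      (minner (dmetric G (c x) c') (a x) (b x) + minner (G (c x)) a' (b x)
        + minner (G (c x)) (a x) b') x := by
  have hGc : ∀ i j, HasDerivAt (fun y => G (c y) i j) (dmetric G (c x) c' i j) x := fun i j =>
    (hG i j (c x)).hasFDerivAt.comp_hasDerivAt x hc
  have h := HasDerivAt.fun_sum (u := Finset.univ) fun i _ =>
    HasDerivAt.fun_sum (u := Finset.univ) fun j _ =>
      (((hasDerivAt_pi.1 ha i).mul (hGc i j)).mul (hasDerivAt_pi.1 hb j))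
  refine h.congr_deriv ?_
  simp only [_root_.minner, ← Finset.sum_add_distrib]
  refine Finset.sum_congr rfl fun i _ => Finset.sum_congr rfl fun j _ => ?_
  simp only [Pi.mul_apply]
  ring

end Metric

section Curve

variable {m : ℕ} {G : (Fin m → ℝ) → Matrix (Fin m) (Fin m) ℝ} {c : ℝ → Fin m → ℝ}

lemma deriv_eq_smul_unitT (hpd : ∀ p, (G p).PosDef) (hreg : ∀ x, deriv c x ≠ 0) (x : ℝ) :
    deriv c x = mnorm (G (c x)) (deriv c x) • unitT G c x := by
  rw [unitT, smul_smul, mul_inv_cancel₀ (mnorm_pos (hpd _) (hreg x)).ne', one_smul]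

lemma minner_unitT_self (hpd : ∀ p, (G p).PosDef) (hreg : ∀ x, deriv c x ≠ 0) (x : ℝ) :
    minner (G (c x)) (unitT G c x) (unitT G c x) = 1 := by
  have h := mnorm_pos (hpd (c x)) (hreg x)
  rw [unitT, minner_smul_left, minner_smul_right, ← sq_mnorm (hpd _) (hreg x)]
  field_simp

lemma differentiable_unitT (hG : ∀ i j, Differentiable ℝ fun p => G p i j)
    (hpd : ∀ p, (G p).PosDef) (hc : Differentiable ℝ c) (hc' : Differentiable ℝ (deriv c))
    (hreg : ∀ x, deriv c x ≠ 0) : Differentiable ℝ (unitT G c) := fun x =>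
  ((((hc x).hasDerivAt.minner hG (hc' x).hasDerivAt (hc' x).hasDerivAt).differentiableAt.sqrt
    (minner_self_pos (hpd _) (hreg x)).ne').inv (mnorm_pos (hpd _) (hreg x)).ne').smul (hc' x)

/-- Inner product of the mean curvature vector with an arbitrary vector `Y`, with the Christoffel
symbols eliminated. -/
lemma mnorm_mul_minner_meanCurv (hG : ∀ i j, Differentiable ℝ fun p => G p i j)
    (hpd : ∀ p, (G p).PosDef) (hc : Differentiable ℝ c) (hc' : Differentiable ℝ (deriv c))
    (hreg : ∀ x, deriv c x ≠ 0) (x : ℝ) (Y : Fin m → ℝ) :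
    mnorm (G (c x)) (deriv c x) * minner (G (c x)) Y (meanCurv G c x) =
      minner (dmetric G (c x) (deriv c x)) Y (unitT G c x)
        + minner (G (c x)) Y (deriv (unitT G c) x)
        - (1 / 2) * minner (dmetric G (c x) Y) (deriv c x) (unitT G c x) := by
  have hv := (mnorm_pos (hpd (c x)) (hreg x)).ne'
  have hT := differentiable_unitT hG hpd hc hc' hreg x
  have hH : meanCurv G c x = (mnorm (G (c x)) (deriv c x))⁻¹ • (deriv (unitT G c) x +
      fun α => ∑ β, ∑ δ, christoffel G (c x) α β δ * deriv c x β * unitT G c x δ) := by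
    ext α
    simp only [meanCurv, covT, Pi.smul_apply, Pi.add_apply, smul_eq_mul]
    rw [(hasDerivAt_pi.1 hT.hasDerivAt α).deriv]
  rw [hH, minner_smul_right, minner_add_right, minner_christoffel (hpd _), ← mul_assoc,
    mul_inv_cancel₀ hv, one_mul]
  have hswap : minner (dmetric G (c x) (unitT G c x)) Y (deriv c x) =
      minner (dmetric G (c x) (deriv c x)) Y (unitT G c x) := by
    rw [unitT, dmetric_smul, minner_smul_matrix, minner_smul_right]
  rw [hswap]
  ring

lemma minner_unitT_meanCurv (hG : ∀ i j, Differentiable ℝ fun p => G p i j)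
    (hsymm : ∀ p, (G p).IsSymm)
    (hpd : ∀ p, (G p).PosDef) (hc : Differentiable ℝ c) (hc' : Differentiable ℝ (deriv c))
    (hreg : ∀ x, deriv c x ≠ 0) (x : ℝ) :
    minner (G (c x)) (unitT G c x) (meanCurv G c x) = 0 := by
  have hv := (mnorm_pos (hpd (c x)) (hreg x)).ne'
  have hT := (differentiable_unitT hG hpd hc hc' hreg x).hasDerivAt
  have h1 := mnorm_mul_minner_meanCurv hG hpd hc hc' hreg x (unitT G c x)
  have h2 := (hc x).hasDerivAt.minner hG hT hT
  simp only [minner_unitT_self hpd hreg] at h2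
  have h3 := h2.unique (hasDerivAt_const x 1)
  rw [minner_comm (hsymm _) (deriv _ _)] at h3
  have h4 : minner (dmetric G (c x) (unitT G c x)) (deriv c x) (unitT G c x) =
      minner (dmetric G (c x) (deriv c x)) (unitT G c x) (unitT G c x) := by
    simp only [unitT, dmetric_smul, minner_smul_matrix, minner_smul_right, minner_smul_left]
  rw [h4] at h1
  refine (mul_eq_zero.1 (h1.trans ?_)).resolve_left hv
  linarith

/-- If `K` is a coordinate vector field along which `G` is constant, then `T⟨T, K⟩ = ⟨H, K⟩`. -/
lemma Tscal_minner_unitT (hG : ∀ i j, Differentiable ℝ fun p => G p i j)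
    (hsymm : ∀ p, (G p).IsSymm)
    (hpd : ∀ p, (G p).PosDef) (hc : Differentiable ℝ c) (hc' : Differentiable ℝ (deriv c))
    (hreg : ∀ x, deriv c x ≠ 0) {K : Fin m → ℝ} (hK : ∀ p, dmetric G p K = 0) (x : ℝ) :
    Tscal G c (fun y => minner (G (c y)) (unitT G c y) K) x =
      minner (G (c x)) (meanCurv G c x) K := by
  have hv := (mnorm_pos (hpd (c x)) (hreg x)).ne'
  have hT := (differentiable_unitT hG hpd hc hc' hreg x).hasDerivAt
  have h1 := mnorm_mul_minner_meanCurv hG hpd hc hc' hreg x K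
  have h2 := (hc x).hasDerivAt.minner hG hT (hasDerivAt_const x K)
  rw [Tscal, h2.deriv, inv_mul_eq_iff_eq_mul₀ hv, minner_comm (hsymm _) (meanCurv _ _ _), h1, hK,
    minner_comm (hsymm _) K, minner_comm (isSymm_dmetric hsymm _ _) K]
  simp [minner]

/-- If the mean curvature vector field `H` is differentiable, then
`⟨∂ₓc, ∂ₓH⟩ = -|∂ₓc|² |H|² - ½ (∂_H G)(∂ₓc, ∂ₓc)`. -/
lemma minner_deriv_deriv_meanCurv (hG : ∀ i j, Differentiable ℝ fun p => G p i j)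
    (hsymm : ∀ p, (G p).IsSymm)
    (hpd : ∀ p, (G p).PosDef) (hc : Differentiable ℝ c) (hc' : Differentiable ℝ (deriv c))
    (hreg : ∀ x, deriv c x ≠ 0) (x : ℝ) (hH : DifferentiableAt ℝ (meanCurv G c) x) :
    minner (G (c x)) (deriv c x) (deriv (meanCurv G c) x) =
      -(mnorm (G (c x)) (deriv c x) ^ 2 * minner (G (c x)) (meanCurv G c x) (meanCurv G c x))
        - (1 / 2) * minner (dmetric G (c x) (meanCurv G c x)) (deriv c x) (deriv c x) := by
  have hT := (differentiable_unitT hG hpd hc hc' hreg x).hasDerivAt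
  have h1 := mnorm_mul_minner_meanCurv hG hpd hc hc' hreg x (meanCurv G c x)
  have h2 := (hc x).hasDerivAt.minner hG hT hH.hasDerivAt
  simp only [minner_unitT_meanCurv hG hsymm hpd hc hc' hreg] at h2
  have h3 := h2.unique (hasDerivAt_const x 0)
  rw [minner_comm (hsymm _) (deriv _ _), minner_comm (isSymm_dmetric hsymm _ _)] at h3
  have h4 := deriv_eq_smul_unitT hpd hreg x
  set v := mnorm (G (c x)) (deriv c x)
  have h5 : minner (G (c x)) (deriv c x) (deriv (meanCurv G c) x) =
      v * minner (G (c x)) (unitT G c x) (deriv (meanCurv G c) x) := by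
    conv_lhs => rw [h4, minner_smul_left]
  have h6 : minner (dmetric G (c x) (meanCurv G c x)) (deriv c x) (deriv c x) =
      v * minner (dmetric G (c x) (meanCurv G c x)) (deriv c x) (unitT G c x) := by
    rw [← minner_smul_right, ← h4]
  rw [h5, h6]
  linear_combination v * h3 + v * h1

end Curve

/-- Equality of mixed partial derivatives of a map of two real variables. -/
lemma hasDerivAt_deriv_of_contDiff {E : Type*} [NormedAddCommGroup E] [NormedSpace ℝ E]
    {γ : ℝ → ℝ → E} (hγ : ContDiff ℝ 2 fun q : ℝ × ℝ => γ q.1 q.2) (x t : ℝ) :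
    HasDerivAt (fun s => deriv (fun y => γ y s) x) (deriv (fun y => deriv (γ y) t) x) t := by
  set F : ℝ × ℝ → E := fun q => γ q.1 q.2 with hF
  have hd : Differentiable ℝ F := hγ.differentiable two_ne_zero
  have hd' : Differentiable ℝ (fderiv ℝ F) :=
    (hγ.fderiv_right (m := 1) le_rfl).differentiable one_ne_zero
  have hl : ∀ y s, HasDerivAt (fun y : ℝ => (y, s)) ((1, 0) : ℝ × ℝ) y := fun y s =>
    (hasDerivAt_id y).prodMk (hasDerivAt_const y s)
  have hr : ∀ y s, HasDerivAt (fun s : ℝ => (y, s)) ((0, 1) : ℝ × ℝ) s := fun y s =>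
    (hasDerivAt_const s y).prodMk (hasDerivAt_id s)
  have h1 : ∀ y s, deriv (fun y => γ y s) y = fderiv ℝ F (y, s) (1, 0) := fun y s =>
    (HasFDerivAt.comp_hasDerivAt (l := F) y (hd (y, s)).hasFDerivAt (hl y s)).deriv
  have h2 : ∀ y s, deriv (γ y) s = fderiv ℝ F (y, s) (0, 1) := fun y s =>
    (HasFDerivAt.comp_hasDerivAt (l := F) s (hd (y, s)).hasFDerivAt (hr y s)).deriv
  have hd2 : ∀ w, HasFDerivAt (fun q => fderiv ℝ F q w)
      ((fderiv ℝ (fderiv ℝ F) (x, t)).flip w) (x, t) := fun w => by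
    simpa using (hd' (x, t)).hasFDerivAt.clm_apply (hasFDerivAt_const w (x, t))
  have h3 := HasFDerivAt.comp_hasDerivAt (l := fun q => fderiv ℝ F q (1, 0)) t
    (hd2 (1, 0)) (hr x t)
  have h4 := HasFDerivAt.comp_hasDerivAt (l := fun q => fderiv ℝ F q (0, 1)) x
    (hd2 (0, 1)) (hl x t)
  have hs : fderiv ℝ (fderiv ℝ F) (x, t) (1, 0) (0, 1) =
      fderiv ℝ (fderiv ℝ F) (x, t) (0, 1) (1, 0) :=
    (hγ.contDiffAt.isSymmSndFDerivAt (by simp)).eq _ _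
  simp only [h1, h2]
  refine h3.congr_deriv ?_
  rw [ContinuousLinearMap.flip_apply, ← hs]
  exact h4.deriv.symm

lemma differentiable_deriv_snd {E : Type*} [NormedAddCommGroup E] [NormedSpace ℝ E]
    {γ : ℝ → ℝ → E} (hγ : ContDiff ℝ 2 fun q : ℝ × ℝ => γ q.1 q.2) (t : ℝ) :
    Differentiable ℝ fun y => deriv (γ y) t := by
  have hd := hγ.differentiable two_ne_zero
  have hd' := (hγ.fderiv_right (m := 1) le_rfl).differentiable one_ne_zero
  have h : (fun y => deriv (γ y) t) =
      fun y => fderiv ℝ (fun q : ℝ × ℝ => γ q.1 q.2) (y, t) (0, 1) := funext fun y =>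
    (HasFDerivAt.comp_hasDerivAt (l := fun q : ℝ × ℝ => γ q.1 q.2) t (hd (y, t)).hasFDerivAt
      ((hasDerivAt_const t y).prodMk (hasDerivAt_id t))).deriv
  rw [h]
  exact (hd'.comp (differentiable_id.prodMk (differentiable_const t))).clm_apply
    (differentiable_const _)

lemma hasFDerivAt_comp_tail {n : ℕ} {f : (Fin n → ℝ) → ℝ} (hf : Differentiable ℝ f)
    (p : Fin (n + 1) → ℝ) :
    HasFDerivAt (fun q : Fin (n + 1) → ℝ => f fun k => q k.succ)
      ((fderiv ℝ f fun k => p k.succ).comp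
        (ContinuousLinearMap.pi fun k : Fin n => ContinuousLinearMap.proj k.succ)) p :=
  HasFDerivAt.comp p (hf _).hasFDerivAt (ContinuousLinearMap.hasFDerivAt
    (ContinuousLinearMap.pi fun k : Fin n =>
      (ContinuousLinearMap.proj k.succ : (Fin (n + 1) → ℝ) →L[ℝ] ℝ)))

section WarpedProduct

variable {n : ℕ} {g : (Fin n → ℝ) → Matrix (Fin n) (Fin n) ℝ} {ψ : (Fin n → ℝ) → ℝ}

lemma contDiff_gwL (hg : ∀ i j, ContDiff ℝ (⊤ : ℕ∞) fun x => g x i j)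
    (hψ : ContDiff ℝ (⊤ : ℕ∞) ψ) (i j : Fin (n + 1)) :
    ContDiff ℝ (⊤ : ℕ∞) fun p => gwL g ψ p i j := by
  have htail : ContDiff ℝ (⊤ : ℕ∞) fun (p : Fin (n + 1) → ℝ) (k : Fin n) => p k.succ :=
    contDiff_pi.2 fun k => contDiff_apply ℝ ℝ k.succ
  refine Fin.cases ?_ (fun i => ?_) i <;> refine Fin.cases ?_ (fun j => ?_) j
  · exact (hψ.comp htail).pow 2
  · exact contDiff_const
  · exact contDiff_const
  · exact (hg i j).comp htail

lemma minner_gwL (p u v : Fin (n + 1) → ℝ) :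
    minner (gwL g ψ p) u v = ψ (fun k => p k.succ) ^ 2 * u 0 * v 0
      + minner (g fun k => p k.succ) (fun k => u k.succ) (fun k => v k.succ) := by
  simp only [minner, Fin.sum_univ_succ, gwL, Matrix.of_apply, Fin.cases_zero, Fin.cases_succ]
  simp only [mul_zero, zero_mul, Finset.sum_const_zero, add_zero, zero_add]
  ring

lemma isSymm_gwL (hgpd : ∀ x, (g x).PosDef) (p : Fin (n + 1) → ℝ) : (gwL g ψ p).IsSymm := by
  ext i j
  refine Fin.cases ?_ (fun i => ?_) i <;> refine Fin.cases ?_ (fun j => ?_) j <;>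
    simp only [gwL, Matrix.transpose_apply, Matrix.of_apply, Fin.cases_zero, Fin.cases_succ]
  simpa using (hgpd _).isHermitian.apply i j

lemma posDef_gwL (hgpd : ∀ x, (g x).PosDef) (hψpos : ∀ x, 0 < ψ x) (p : Fin (n + 1) → ℝ) :
    (gwL g ψ p).PosDef := by
  refine Matrix.PosDef.of_dotProduct_mulVec_pos ?_ fun u hu => ?_
  · rw [Matrix.IsHermitian, Matrix.conjTranspose_eq_transpose_of_trivial]
    exact isSymm_gwL hgpd p
  · rw [star_trivial, ← minner_eq_dotProduct, minner_gwL]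
    have hψ' := hψpos fun k => p k.succ
    by_cases h : (fun k : Fin n => u k.succ) = 0
    · have h0 : u 0 ≠ 0 := fun h0 => hu (funext fun i => Fin.cases h0 (congrFun h) i)
      have : minner (g fun k => p k.succ) (fun k => u k.succ) (fun k => u k.succ) = 0 := by
        rw [h]; simp [minner]
      rw [this]
      have := mul_self_pos.2 h0
      rw [mul_assoc]
      positivity
    · have := minner_self_pos (hgpd fun k => p k.succ) h
      have := mul_self_nonneg (u 0)
      rw [mul_assoc]
      positivity

lemma minner_er (M : Matrix (Fin (n + 1)) (Fin (n + 1)) ℝ) (u : Fin (n + 1) → ℝ) :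
    minner M u (er n) = ∑ i, u i * M i 0 := by
  simp [minner, er, Pi.single_apply]

lemma dmetric_gwL_er (hg : ∀ i j, Differentiable ℝ fun x => g x i j)
    (hψ : Differentiable ℝ ψ) (p : Fin (n + 1) → ℝ) :
    dmetric (gwL g ψ) p (er n) = 0 := by
  have h : ∀ f : (Fin n → ℝ) → ℝ, Differentiable ℝ f →
      fderiv ℝ (fun q : Fin (n + 1) → ℝ => f fun k => q k.succ) p (er n) = 0 := fun f hf => by
    rw [(hasFDerivAt_comp_tail hf p).fderiv]
    have : (fun k : Fin n => er n k.succ) = 0 := by ext k; simp [er]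
    simp [this]
  ext i j
  refine Fin.cases ?_ (fun i => ?_) i <;> refine Fin.cases ?_ (fun j => ?_) j <;>
    simp only [dmetric, gwL, Matrix.of_apply, Fin.cases_zero, Fin.cases_succ, Matrix.zero_apply]
  · exact h (fun x => ψ x ^ 2) (hψ.pow 2)
  · simp
  · simp
  · exact h _ (hg i j)

lemma minner_gwL_DlogPsi (hgpd : ∀ x, (g x).PosDef) (hψ : Differentiable ℝ ψ)
    (hψpos : ∀ x, 0 < ψ x) (p w : Fin (n + 1) → ℝ) :
    minner (gwL g ψ p) w (DlogPsi g ψ fun k => p k.succ) =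
      (ψ fun k => p k.succ)⁻¹ * fderiv ℝ ψ (fun k => p k.succ) (fun k => w k.succ) := by
  set x : Fin n → ℝ := fun k => p k.succ
  set f : Fin n → ℝ := fun k => fderiv ℝ (fun y => Real.log (ψ y)) x (Pi.single k 1) with hf
  have hD : (fun k : Fin n => DlogPsi g ψ x k.succ) = (g x)⁻¹.mulVec f := by
    ext k; simp [DlogPsi, Matrix.mulVec, dotProduct, hf]
  have h0 : DlogPsi g ψ x 0 = 0 := rfl
  rw [minner_gwL, h0, hD, minner_eq_dotProduct, Matrix.mulVec_mulVec, Matrix.mul_nonsing_inv _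
      ((Matrix.isUnit_iff_isUnit_det _).1 (hgpd x).isUnit), Matrix.one_mulVec, mul_zero, zero_add]
  have hlog : fderiv ℝ (fun y => Real.log (ψ y)) x = (ψ x)⁻¹ • fderiv ℝ ψ x :=
    ((hψ x).hasFDerivAt.log (hψpos x).ne').fderiv
  have hw := LinearMap.pi_apply_eq_sum_univ (fderiv ℝ ψ x).toLinearMap fun k => w k.succ
  simp only [ContinuousLinearMap.coe_coe, smul_eq_mul] at hw
  rw [hw, Finset.mul_sum]
  refine Finset.sum_congr rfl fun k _ => ?_
  have : (Pi.single k 1 : Fin n → ℝ) = fun j => if k = j then 1 else 0 := by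
    ext j; simp [Pi.single_apply, eq_comm]
  simp only [hf, hlog, this, smul_eq_mul, _root_.smul_apply]
  ring

lemma minner_dmetric_gwL_er (hgpd : ∀ x, (g x).PosDef) (hψ : Differentiable ℝ ψ)
    (hψpos : ∀ x, 0 < ψ x) (p w u : Fin (n + 1) → ℝ) :
    minner (dmetric (gwL g ψ) p w) u (er n) =
      2 * minner (gwL g ψ p) w (DlogPsi g ψ fun k => p k.succ)
        * minner (gwL g ψ p) u (er n) := by
  rw [minner_gwL_DlogPsi hgpd hψ hψpos, minner_er, minner_er, Fin.sum_univ_succ,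
    Fin.sum_univ_succ]
  have h0 : dmetric (gwL g ψ) p w 0 0 =
      2 * (ψ fun k => p k.succ) * fderiv ℝ ψ (fun k => p k.succ) (fun k => w k.succ) := by
    have h := hasFDerivAt_comp_tail (f := fun x => ψ x ^ 2) (hψ.pow 2) p
    have h' : fderiv ℝ (fun x => ψ x ^ 2) (fun k => p k.succ) = _ :=
      ((hψ fun k => p k.succ).hasFDerivAt.pow 2).fderiv
    simp only [dmetric, gwL, Matrix.of_apply, Fin.cases_zero]
    rw [h.fderiv, h']
    simp
  have hs : ∀ i : Fin n, dmetric (gwL g ψ) p w i.succ 0 = 0 := fun i => by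
    simp [dmetric, gwL]
  have hs' : ∀ i : Fin n, gwL g ψ p i.succ 0 = 0 := fun i => rfl
  have h0' : gwL g ψ p 0 0 = (ψ fun k => p k.succ) ^ 2 := rfl
  simp only [h0, hs, hs', h0', mul_zero, Finset.sum_const_zero, add_zero]
  have := (hψpos fun k => p k.succ).ne'
  field_simp

end WarpedProduct

/-- Evolution equation of the angle function `Θ_L` along a curve shortening flow
in the left warped product. -/
theorem stmt7 {n : ℕ} (hn : 1 ≤ n)
    (g : (Fin n → ℝ) → Matrix (Fin n) (Fin n) ℝ)
    (hg : ∀ i j, ContDiff ℝ (⊤ : ℕ∞) fun x => g x i j)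
    (hgpd : ∀ x, (g x).PosDef)
    (ψ : (Fin n → ℝ) → ℝ) (hψ : ContDiff ℝ (⊤ : ℕ∞) ψ) (hψpos : ∀ x, 0 < ψ x)
    (t₀ : ℝ) (γ : ℝ → ℝ → Fin (n + 1) → ℝ)
    (hγ : ContDiff ℝ (⊤ : ℕ∞) fun q : ℝ × ℝ => γ q.1 q.2)
    (hreg : ∀ x t, deriv (fun y => γ y t) x ≠ 0)
    (hflow : ∀ x : ℝ, ∀ t ∈ Set.Ico (0 : ℝ) t₀,
      deriv (γ x) t = meanCurv (gwL g ψ) (fun y => γ y t) x)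
    (x : ℝ) (t : ℝ) (ht : t ∈ Set.Ico (0 : ℝ) t₀) :
    deriv (fun s => thetaL g ψ γ x s) t
      = lapScal (gwL g ψ) (fun y => γ y t) (fun y => thetaL g ψ γ y t) x
        + minner (gwL g ψ (γ x t)) (meanCurv (gwL g ψ) (fun y => γ y t) x)
            (meanCurv (gwL g ψ) (fun y => γ y t) x) * thetaL g ψ γ x t
        + 2 * minner (gwL g ψ (γ x t)) (meanCurv (gwL g ψ) (fun y => γ y t) x)
            (DlogPsi g ψ (fun i => γ x t i.succ)) * thetaL g ψ γ x t
        - 2 * Tscal (gwL g ψ) (fun y => γ y t) (fun y => thetaL g ψ γ y t) x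
            * minner (gwL g ψ (γ x t)) (unitT (gwL g ψ) (fun y => γ y t) x)
                (DlogPsi g ψ (fun i => γ x t i.succ)) := by
  have hG := contDiff_gwL hg hψ
  have hGd : ∀ i j, Differentiable ℝ fun p => gwL g ψ p i j := fun i j =>
    (hG i j).differentiable (by simp)
  have hψd : Differentiable ℝ ψ := hψ.differentiable (by simp)
  have hgd : ∀ i j, Differentiable ℝ fun x => g x i j := fun i j =>
    (hg i j).differentiable (by simp)
  have hsymm : ∀ p, (gwL g ψ p).IsSymm := isSymm_gwL hgpd
  have hpd : ∀ p, (gwL g ψ p).PosDef := posDef_gwL hgpd hψpos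
  have hKG := dmetric_gwL_er hgd hψd
  have hD := minner_dmetric_gwL_er hgpd hψd hψpos
  have hc : ContDiff ℝ (⊤ : ℕ∞) fun y => γ y t := hγ.comp (contDiff_id.prodMk contDiff_const)
  have hcd : Differentiable ℝ fun y => γ y t := hc.differentiable (by simp)
  have hcd' : Differentiable ℝ (deriv fun y => γ y t) :=
    ((contDiff_infty_iff_deriv.1 hc).2).differentiable (by simp)
  have hγ2 : ContDiff ℝ 2 fun q : ℝ × ℝ => γ q.1 q.2 := by exact_mod_cast contDiff_infty.1 hγ 2
  have hreg' : ∀ y, deriv (fun y => γ y t) y ≠ 0 := fun y => hreg y t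
  have hH : (fun y => deriv (γ y) t) = meanCurv (gwL g ψ) fun y => γ y t :=
    funext fun y => hflow y t ht
  have hHd : Differentiable ℝ (meanCurv (gwL g ψ) fun y => γ y t) := by
    rw [← hH]
    exact differentiable_deriv_snd hγ2 t
  have hγt : HasDerivAt (γ x) (meanCurv (gwL g ψ) (fun y => γ y t) x) t := by
    rw [← hflow x t ht]
    have h : Differentiable ℝ (γ x) := (hγ.comp
      (contDiff_const.prodMk contDiff_id : ContDiff ℝ (⊤ : ℕ∞) fun s => (x, s))).differentiable
        (by simp)
    exact (h t).hasDerivAt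
  have hXt := hasDerivAt_deriv_of_contDiff hγ2 x t
  rw [hH] at hXt
  have hΘ := Tscal_minner_unitT hGd hsymm hpd hcd hcd' hreg' hKG
  have hlap : lapScal (gwL g ψ) (fun y => γ y t) (fun y => thetaL g ψ γ y t) x =
      Tscal (gwL g ψ) (fun y => γ y t) (fun y => minner (gwL g ψ (γ y t))
        (meanCurv (gwL g ψ) (fun y => γ y t) y) (er n)) x :=
    congrArg (fun f => Tscal (gwL g ψ) (fun y => γ y t) f x) (funext hΘ)
  have hlap' := (hcd x).hasDerivAt.minner hGd (hHd x).hasDerivAt (hasDerivAt_const x (er n))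
  have hXX := hγt.minner hGd hXt hXt
  have hXK := hγt.minner hGd hXt (hasDerivAt_const t (er n))
  have hpos := minner_self_pos (hpd (γ x t)) (hreg' x)
  have hev := minner_deriv_deriv_meanCurv hGd hsymm hpd hcd hcd' hreg' x (hHd x)
  have hv := mnorm_pos (hpd (γ x t)) (hreg' x)
  have hvt : HasDerivAt (fun s => (mnorm (gwL g ψ (γ x s)) (deriv (fun y => γ y s) x))⁻¹)
      (minner (gwL g ψ (γ x t)) (meanCurv (gwL g ψ) (fun y => γ y t) x)
        (meanCurv (gwL g ψ) (fun y => γ y t) x) *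
          (mnorm (gwL g ψ (γ x t)) (deriv (fun y => γ y t) x))⁻¹) t := by
    refine ((hXX.sqrt hpos.ne').inv hv.ne').congr_deriv ?_
    rw [minner_comm (hsymm _) (deriv (meanCurv _ _) x), hev]
    change -(_ / (2 * mnorm (gwL g ψ (γ x t)) (deriv (fun y => γ y t) x))) /
      mnorm (gwL g ψ (γ x t)) (deriv (fun y => γ y t) x) ^ 2 = _
    field_simp
    ring
  have hθ : ∀ s, thetaL g ψ γ x s = (mnorm (gwL g ψ (γ x s)) (deriv (fun y => γ y s) x))⁻¹ *
      minner (gwL g ψ (γ x s)) (deriv (fun y => γ y s) x) (er n) := fun s =>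
    minner_smul_left _ _ _ _
  have hT : ∀ Y, minner (gwL g ψ (γ x t)) (unitT (gwL g ψ) (fun y => γ y t) x) Y =
      (mnorm (gwL g ψ (γ x t)) (deriv (fun y => γ y t) x))⁻¹ *
        minner (gwL g ψ (γ x t)) (deriv (fun y => γ y t) x) Y := fun Y =>
    minner_smul_left _ _ _ _
  have hzero : ∀ u, minner (gwL g ψ (γ x t)) u 0 = 0 := fun u => by simp [minner]
  have hderiv := hvt.mul hXK
  have hΘx : Tscal (gwL g ψ) (fun y => γ y t) (fun y => thetaL g ψ γ y t) x = _ := hΘ x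
  rw [hlap, Tscal, hlap'.deriv, hΘx, hT]
  simp only [hθ]
  refine hderiv.deriv.trans ?_
  simp only [hD, hzero]
  ring

end
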